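/- arXiv:1503.00766 — 10 statements merged into one kernel-verified Lean document; each statement's English description precedes it below -/
import Mathlib

section
/- For every roll-off parameter α ∈ (0,1) and every w ∈ ℝ, the raised cosine spectrum satisfies the Nyquist criterion: ∑_{l ∈ ℤ} P_α(w + 2πl) = 1/(2π). -/
/-- The raised cosine spectrum with roll-off parameter `α`. -/
noncomputable def raisedCosine (α w : ℝ) : ℝ :=
  if |w| < (1 - α) * Real.pi then 1 / (2 * Real.pi)
  else if |w| < (1 + α) * Real.pi then
    (1 / (4 * Real.pi)) * (1 + Real.cos ((|w| - (1 - α) * Real.pi) / (2 * α)))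
  else 0

theorem rc_pair (α : ℝ) (h0 : 0 < α) (h1 : α < 1) (v : ℝ) (hv0 : 0 ≤ v)
    (hv1 : v < 2 * Real.pi) :
    raisedCosine α v + raisedCosine α (v - 2 * Real.pi) = 1 / (2 * Real.pi) := by
  have hp := Real.pi_pos
  have hap : 0 < α * Real.pi := mul_pos h0 hp
  have e1 : |v| = v := abs_of_nonneg hv0
  have e2 : |v - 2 * Real.pi| = 2 * Real.pi - v := by
    rw [abs_of_nonpos (by linarith)]; ring
  unfold raisedCosine
  rw [e1, e2]
  rcases lt_trichotomy v ((1 - α) * Real.pi) with h | h | h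
  · rw [if_pos h, if_neg (by linarith), if_neg (by linarith), add_zero]
  · rw [if_neg (by linarith), if_pos (by linarith), if_neg (by linarith), if_neg (by linarith), h]
    simp
    field_simp
    norm_num
  · rcases lt_trichotomy v ((1 + α) * Real.pi) with h' | h' | h'
    · rw [if_neg (by linarith), if_pos h', if_neg (by linarith), if_pos (by linarith)]
      have : (2 * Real.pi - v - (1 - α) * Real.pi) / (2 * α)
          = Real.pi - (v - (1 - α) * Real.pi) / (2 * α) := by
        field_simp
        ring
      rw [this, Real.cos_pi_sub]
      field_simp
      ring
    · rw [if_neg (by linarith), if_neg (by linarith), if_neg (by linarith), if_pos (by linarith)]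
      have : 2 * Real.pi - v - (1 - α) * Real.pi = 0 := by rw [h']; ring
      rw [this]
      simp
      field_simp
      norm_num
    · rw [if_neg (by linarith), if_neg (by linarith), if_pos (by linarith), zero_add]

theorem rc_zero (α : ℝ) (h1 : α < 1) (x : ℝ) (h0 : 0 < α) (hx : 2 * Real.pi ≤ |x|) :
    raisedCosine α x = 0 := by
  have hp := Real.pi_pos
  have hap : 0 < α * Real.pi := mul_pos h0 hp
  have hap' : α * Real.pi < 1 * Real.pi := mul_lt_mul_of_pos_right h1 hp
  unfold raisedCosine
  rw [if_neg (by linarith), if_neg (by linarith)]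

/-- For every roll-off parameter `α ∈ (0,1)` and every `w ∈ ℝ`, the raised cosine
spectrum satisfies the Nyquist criterion: `∑_{l ∈ ℤ} P_α(w + 2πl) = 1/(2π)`. -/
theorem raisedCosine_nyquist_criterion (α : ℝ) (hα : α ∈ Set.Ioo (0 : ℝ) 1) (w : ℝ) :
    ∑' l : ℤ, raisedCosine α (w + 2 * Real.pi * l) = 1 / (2 * Real.pi) := by
  obtain ⟨h0, h1⟩ := hα
  have hp := Real.pi_pos
  have hp2 : 0 < 2 * Real.pi := by positivity
  obtain ⟨n, hn, -⟩ := existsUnique_add_zsmul_mem_Ico hp2 w 0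
  rw [zsmul_eq_mul] at hn
  obtain ⟨hv0, hv1⟩ := hn
  set v := w + n * (2 * Real.pi) with hv
  rw [← (Equiv.addRight n).tsum_eq (fun l : ℤ => raisedCosine α (w + 2 * Real.pi * l))]
  have hf : ∀ l : ℤ, raisedCosine α (w + 2 * Real.pi * ((Equiv.addRight n l : ℤ) : ℝ))
      = raisedCosine α (v + 2 * Real.pi * l) := by
    intro l
    congr 1
    simp only [Equiv.coe_addRight, Int.cast_add, hv]
    ring
  simp_rw [hf]
  rw [tsum_eq_sum (s := {0, -1})]
  · rw [Finset.sum_pair (by norm_num)]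
    rw [← rc_pair α h0 h1 v hv0 (by linarith)]
    congr 2
    · simp
    · push_cast; ring
  · intro l hl
    apply rc_zero α h1 _ h0
    simp only [Finset.mem_insert, Finset.mem_singleton, not_or] at hl
    have : 1 ≤ l ∨ l ≤ -2 := by omega
    rcases this with h | h
    · have h' : (1 : ℝ) ≤ l := by exact_mod_cast h
      have := mul_le_mul_of_nonneg_left h' hp2.le
      exact le_trans (by linarith) (le_abs_self _)
    · have h' : (l : ℝ) ≤ -2 := by exact_mod_cast h
      have := mul_le_mul_of_nonneg_left h' hp2.le
      exact le_trans (by linarith) (neg_le_abs _)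
end

section
/- For every roll-off parameter α ∈ (0,1) and every t ∈ ℝ with (2αt)² ≠ 1, the inverse Fourier transform of the raised cosine spectrum is the generalised Shannon scaling function: ∫_{ℝ} P_α(w)·cos(wt) dw = Sinc(t)·cos(παt)/(1 − (2αt)²). -/
/-- `Sinc(t) = sin(πt)/(πt)` with `Sinc(0) = 1`. -/
noncomputable def Sinc (t : ℝ) : ℝ :=
  if t = 0 then 1 else Real.sin (Real.pi * t) / (Real.pi * t)

theorem rc_aux_cos (t x y : ℝ) (h : t ≠ 0) :
    ∫ w in x..y, Real.cos (w * t) = Real.sin (y * t) / t - Real.sin (x * t) / t := by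
  apply intervalIntegral.integral_eq_sub_of_hasDerivAt (f := fun w => Real.sin (w * t) / t)
  · intro w _
    have h1 : HasDerivAt (fun w : ℝ => w * t) t w := by
      simpa using (hasDerivAt_id w).mul_const t
    refine ((h1.sin).div_const t).congr_deriv ?_
    field_simp
  · exact Continuous.intervalIntegrable (by fun_prop) _ _

theorem rc_aux_coscos (t k a x y : ℝ) (h : k ^ 2 - t ^ 2 ≠ 0) :
    ∫ w in x..y, Real.cos (k * (w - a)) * Real.cos (w * t) =
      (k * (Real.sin (k * (y - a)) * Real.cos (y * t))
        - t * (Real.cos (k * (y - a)) * Real.sin (y * t))) / (k ^ 2 - t ^ 2)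
      - (k * (Real.sin (k * (x - a)) * Real.cos (x * t))
        - t * (Real.cos (k * (x - a)) * Real.sin (x * t))) / (k ^ 2 - t ^ 2) := by
  apply intervalIntegral.integral_eq_sub_of_hasDerivAt
    (f := fun w => (k * (Real.sin (k * (w - a)) * Real.cos (w * t))
        - t * (Real.cos (k * (w - a)) * Real.sin (w * t))) / (k ^ 2 - t ^ 2))
  · intro w _
    have h1 : HasDerivAt (fun w : ℝ => w * t) t w := by
      simpa using (hasDerivAt_id w).mul_const t
    have h2 : HasDerivAt (fun w : ℝ => k * (w - a)) k w := by
      simpa using ((hasDerivAt_id w).sub_const a).const_mul k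
    refine (((((h2.sin).mul h1.cos).const_mul k).sub
      (((h2.cos).mul h1.sin).const_mul t)).div_const (k ^ 2 - t ^ 2)).congr_deriv ?_
    field_simp
    ring
  · exact Continuous.intervalIntegrable (by fun_prop) _ _

/-- For every roll-off parameter `α ∈ (0,1)` and every `t ∈ ℝ` with `(2αt)² ≠ 1`, the inverse
Fourier transform of the raised cosine spectrum is the generalised Shannon scaling function:
`∫_{ℝ} P_α(w)·cos(wt) dw = Sinc(t)·cos(παt)/(1 − (2αt)²)`. -/
theorem raisedCosine_inverse_fourier (α : ℝ) (hα : α ∈ Set.Ioo (0 : ℝ) 1) (t : ℝ)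
    (ht : (2 * α * t) ^ 2 ≠ 1) :
    ∫ w : ℝ, raisedCosine α w * Real.cos (w * t)
      = Sinc t * Real.cos (Real.pi * α * t) / (1 - (2 * α * t) ^ 2) := by
  obtain ⟨h0, h1⟩ := hα
  have hpi := Real.pi_pos
  obtain ⟨a, ha⟩ : ∃ a, a = (1 - α) * Real.pi := ⟨_, rfl⟩
  obtain ⟨b, hb⟩ : ∃ b, b = (1 + α) * Real.pi := ⟨_, rfl⟩
  obtain ⟨k, hk⟩ : ∃ k, k = 1 / (2 * α) := ⟨_, rfl⟩
  have ha0 : 0 < a := by rw [ha]; exact mul_pos (by linarith) hpi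
  have hab : a < b := by rw [ha, hb]; nlinarith
  have hkba : k * (b - a) = Real.pi := by rw [ha, hb, hk]; field_simp; ring
  have hkt : k ^ 2 - t ^ 2 ≠ 0 := by
    intro h
    apply ht
    have : t ^ 2 = k ^ 2 := by linarith
    rw [mul_pow, this, hk]
    field_simp
  have e1 : ∀ w ∈ Set.uIcc 0 a, raisedCosine α w * Real.cos (w * t)
      = 1 / (2 * Real.pi) * Real.cos (w * t) := by
    intro w hw
    rw [Set.uIcc_of_le ha0.le] at hw
    congr 1
    unfold raisedCosine
    rw [← ha, ← hb, abs_of_nonneg hw.1]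
    rcases hw.2.lt_or_eq with h | h
    · rw [if_pos h]
    · subst h
      rw [if_neg (lt_irrefl _), if_pos hab]
      simp
      field_simp
      norm_num
  have e2 : ∀ w ∈ Set.uIcc a b, raisedCosine α w * Real.cos (w * t)
      = 1 / (4 * Real.pi) * (Real.cos (w * t) + Real.cos (k * (w - a)) * Real.cos (w * t)) := by
    intro w hw
    rw [Set.uIcc_of_le hab.le] at hw
    have : raisedCosine α w = 1 / (4 * Real.pi) * (1 + Real.cos (k * (w - a))) := by
      unfold raisedCosine
      rw [← ha, ← hb, abs_of_nonneg (ha0.le.trans hw.1), if_neg (not_lt.2 hw.1)]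
      rcases hw.2.lt_or_eq with h | h
      · rw [if_pos h, hk]
        congr 3
        ring
      · rw [h, if_neg (lt_irrefl _), hkba]
        simp
    rw [this]
    ring
  have i1 : IntervalIntegrable (fun w => raisedCosine α w * Real.cos (w * t))
      MeasureTheory.volume 0 a :=
    (ContinuousOn.congr (Continuous.continuousOn (by fun_prop)) e1).intervalIntegrable
  have i2 : IntervalIntegrable (fun w => raisedCosine α w * Real.cos (w * t))
      MeasureTheory.volume a b :=
    (ContinuousOn.congr (Continuous.continuousOn (by fun_prop)) e2).intervalIntegrable
  have key : ∫ w : ℝ, raisedCosine α w * Real.cos (w * t)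
      = 2 * ((1 / (2 * Real.pi) * ∫ w in (0:ℝ)..a, Real.cos (w * t))
        + 1 / (4 * Real.pi) * ((∫ w in a..b, Real.cos (w * t))
          + ∫ w in a..b, Real.cos (k * (w - a)) * Real.cos (w * t))) := by
    have s1 : ∫ w : ℝ, raisedCosine α w * Real.cos (w * t)
        = 2 * ∫ w in Set.Ioi (0:ℝ), raisedCosine α w * Real.cos (w * t) := by
      rw [← integral_comp_abs (f := fun w => raisedCosine α w * Real.cos (w * t))]
      congr 1
      ext w
      congr 1
      · simp [raisedCosine]
      · rcases abs_choice w with h | h <;> rw [h]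
        rw [neg_mul, Real.cos_neg]
    have s2 : ∫ w in Set.Ioi (0:ℝ), raisedCosine α w * Real.cos (w * t)
        = ∫ w in Set.Ioc (0:ℝ) b, raisedCosine α w * Real.cos (w * t) := by
      apply MeasureTheory.setIntegral_eq_of_subset_of_forall_sdiff_eq_zero measurableSet_Ioi
      · exact fun x hx => hx.1
      · intro x hx
        have hx0 : 0 < x := hx.1
        have hxb : b < x := by
          by_contra h
          exact hx.2 ⟨hx0, not_lt.1 h⟩
        unfold raisedCosine
        rw [← ha, ← hb, abs_of_pos hx0, if_neg (by linarith), if_neg (by linarith), zero_mul]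
    rw [s1, s2, ← intervalIntegral.integral_of_le (ha0.trans hab).le,
      ← intervalIntegral.integral_add_adjacent_intervals i1 i2,
      intervalIntegral.integral_congr e1, intervalIntegral.integral_congr e2,
      intervalIntegral.integral_const_mul, intervalIntegral.integral_const_mul,
      intervalIntegral.integral_add]
    · exact Continuous.intervalIntegrable (by fun_prop) _ _
    · exact Continuous.intervalIntegrable (by fun_prop) _ _
  rw [key, rc_aux_coscos t k a a b hkt, hkba]
  by_cases h : t = 0
  · subst h
    simp [Sinc]
    rw [ha, hb]
    field_simp
    ring
  · rw [rc_aux_cos t _ _ h, rc_aux_cos t _ _ h]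
    have hS : Real.sin (b * t) = 2 * (Real.sin (Real.pi * t) * Real.cos (Real.pi * α * t))
        - Real.sin (a * t) := by
      have x1 : b * t = Real.pi * t + Real.pi * α * t := by rw [hb]; ring
      have x2 : a * t = Real.pi * t - Real.pi * α * t := by rw [ha]; ring
      rw [x1, x2, Real.sin_add, Real.sin_sub]
      ring
    have hD : 1 - (2 * α * t) ^ 2 = (k ^ 2 - t ^ 2) / k ^ 2 := by
      rw [hk]; field_simp
    have hk0 : k ≠ 0 := by rw [hk]; positivity
    rw [hD, hS, Sinc, if_neg h]
    simp
    field_simp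
    ring
end

section
/- For every roll-off parameter α ∈ (0,1) and every integer n, the raised cosine spectrum eliminates inter-symbolic interference: ∫_{ℝ} P_α(w)·e^{inw} dw equals 1 if n = 0 and equals 0 if n ≠ 0; equivalently, the generalised Shannon scaling function has zero crossings at all nonzero integers. -/
theorem rc_clamp (α : ℝ) (hα : α ∈ Set.Ioo (0 : ℝ) 1) (w : ℝ) :
    raisedCosine α w = (1 / (4 * Real.pi)) *
      (1 + Real.cos (max 0 (min Real.pi ((|w| - (1 - α) * Real.pi) / (2 * α))))) := by
  obtain ⟨h0, h1⟩ := hα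
  have hpi := Real.pi_pos
  unfold raisedCosine
  split_ifs with ha hb
  · have : (|w| - (1 - α) * Real.pi) / (2 * α) ≤ 0 :=
      div_nonpos_of_nonpos_of_nonneg (by linarith) (by linarith)
    rw [min_eq_right (by linarith), max_eq_left this, Real.cos_zero]
    field_simp
    norm_num
  · have h2 : 0 ≤ (|w| - (1 - α) * Real.pi) / (2 * α) :=
      div_nonneg (by linarith) (by linarith)
    have h3 : (|w| - (1 - α) * Real.pi) / (2 * α) ≤ Real.pi := by
      rw [div_le_iff₀ (by linarith)]; nlinarith
    rw [min_eq_right h3, max_eq_right h2]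
  · have h3 : Real.pi ≤ (|w| - (1 - α) * Real.pi) / (2 * α) := by
      rw [le_div_iff₀ (by linarith)]; nlinarith
    rw [min_eq_left h3, max_eq_right hpi.le, Real.cos_pi]
    ring

theorem rc_cont (α : ℝ) (hα : α ∈ Set.Ioo (0 : ℝ) 1) : Continuous (raisedCosine α) := by
  rw [funext (rc_clamp α hα)]
  fun_prop

theorem rc_sum (α : ℝ) (hα : α ∈ Set.Ioo (0 : ℝ) 1) (w : ℝ) (hw : 0 ≤ w)
    (hw2 : w ≤ 2 * Real.pi) :
    raisedCosine α w + raisedCosine α (w - 2 * Real.pi) = 1 / (2 * Real.pi) := by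
  rw [rc_clamp α hα, rc_clamp α hα, abs_of_nonneg hw, abs_of_nonpos (by linarith)]
  obtain ⟨h0, h1⟩ := hα
  have hpi := Real.pi_pos
  set t := (w - (1 - α) * Real.pi) / (2 * α) with ht
  have e : (-(w - 2 * Real.pi) - (1 - α) * Real.pi) / (2 * α) = Real.pi - t := by
    rw [ht]; field_simp; ring
  have e2 : max 0 (min Real.pi (Real.pi - t)) = Real.pi - max 0 (min Real.pi t) := by
    grind
  rw [e, e2, Real.cos_pi_sub]
  field_simp
  ring

theorem rc_zero_s3 (α : ℝ) (hα : α ∈ Set.Ioo (0 : ℝ) 1) (w : ℝ) (hw : 2 * Real.pi ≤ |w|) :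
    raisedCosine α w = 0 := by
  obtain ⟨h0, h1⟩ := hα
  have hpi := Real.pi_pos
  unfold raisedCosine
  rw [if_neg (by nlinarith), if_neg (by nlinarith)]

/-- For every roll-off parameter `α ∈ (0,1)` and every integer `n`, the raised cosine spectrum
eliminates inter-symbolic interference: `∫_{ℝ} P_α(w)·e^{inw} dw` equals `1` if `n = 0` and
equals `0` if `n ≠ 0` (i.e. the generalised Shannon scaling function has zero crossings at all
nonzero integers). -/
theorem raisedCosine_no_ISI (α : ℝ) (hα : α ∈ Set.Ioo (0 : ℝ) 1) (n : ℤ) :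
    ∫ w : ℝ, (raisedCosine α w : ℂ) * Complex.exp (Complex.I * n * w)
      = if n = 0 then 1 else 0 := by
  have hpi := Real.pi_pos
  have hc := rc_cont α hα
  set f : ℝ → ℂ := fun w => (raisedCosine α w : ℂ) * Complex.exp (Complex.I * n * w) with hf
  have hfc : Continuous f := by fun_prop
  have hsupp : Function.support f ⊆ Set.Ioc (-(2 * Real.pi)) (2 * Real.pi) := by
    intro w hw
    have : |w| < 2 * Real.pi := by
      by_contra h
      apply hw
      simp [hf, rc_zero_s3 α hα w (not_lt.mp h)]
    rw [abs_lt] at this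
    exact ⟨this.1, this.2.le⟩
  rw [← intervalIntegral.integral_eq_integral_of_support_subset hsupp,
    ← intervalIntegral.integral_add_adjacent_intervals (b := 0)
      (hfc.intervalIntegrable _ _) (hfc.intervalIntegrable _ _)]
  have hs : ∫ w in (-(2 * Real.pi))..0, f w = ∫ w in (0:ℝ)..(2 * Real.pi), f (w - 2 * Real.pi) := by
    rw [intervalIntegral.integral_comp_sub_right]
    simp
  have hfc2 : Continuous fun w => f (w - 2 * Real.pi) := by fun_prop
  rw [hs, ← intervalIntegral.integral_add
    (hfc2.intervalIntegrable _ _) (hfc.intervalIntegrable _ _)]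
  have hcongr : ∫ w in (0:ℝ)..(2 * Real.pi), (f (w - 2 * Real.pi) + f w)
      = ∫ w in (0:ℝ)..(2 * Real.pi), (1 / (2 * Real.pi) : ℂ) * Complex.exp (Complex.I * n * w) := by
    apply intervalIntegral.integral_congr
    intro w hw
    rw [Set.uIcc_of_le (by positivity)] at hw
    have h := rc_sum α hα w hw.1 hw.2
    have h' : (raisedCosine α w : ℂ) + raisedCosine α (w - 2 * Real.pi) = 1 / (2 * Real.pi) := by
      exact_mod_cast congrArg (fun x : ℝ => (x : ℂ)) h
    have he : Complex.exp (Complex.I * n * ((w - 2 * Real.pi : ℝ) : ℂ))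
        = Complex.exp (Complex.I * n * w) := by
      rw [Complex.exp_eq_exp_iff_exists_int]
      exact ⟨-n, by push_cast; ring⟩
    simp only [hf]
    rw [he, ← h']
    ring
  rw [hcongr, intervalIntegral.integral_const_mul]
  have hpc : (Real.pi : ℂ) ≠ 0 := by exact_mod_cast hpi.ne'
  split_ifs with hn
  · subst hn
    simp
    field_simp
  · have hne : Complex.I * (n : ℂ) ≠ 0 :=
      mul_ne_zero Complex.I_ne_zero (by exact_mod_cast hn)
    rw [integral_exp_mul_complex hne]
    have : Complex.exp (Complex.I * n * ((2 * Real.pi : ℝ) : ℂ)) = 1 := by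
      rw [Complex.exp_eq_one_iff]
      exact ⟨n, by push_cast; ring⟩
    rw [this]
    simp
end

section
/- For every roll-off parameter α ∈ (0,1) and every w ∈ ℝ, the square-root raised cosine spectrum satisfies Meyer's central condition for an orthogonal multiresolution analysis: ∑_{n ∈ ℤ} Φ_α(w + 2πn)² = 1/(2π). -/
/-- The square-root raised cosine spectrum with roll-off parameter `α`. -/
noncomputable def sqrtRaisedCosine (α w : ℝ) : ℝ :=
  if |w| < (1 - α) * Real.pi then 1 / Real.sqrt (2 * Real.pi)
  else if |w| < (1 + α) * Real.pi then
    (1 / Real.sqrt (2 * Real.pi)) * Real.cos ((|w| - (1 - α) * Real.pi) / (4 * α))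
  else 0

theorem src_low (α w : ℝ) (h0 : 0 < α) (h : |w| ≤ (1 - α) * Real.pi) :
    sqrtRaisedCosine α w = 1 / Real.sqrt (2 * Real.pi) := by
  have hp := Real.pi_pos
  unfold sqrtRaisedCosine
  rcases h.lt_or_eq with h | h
  · rw [if_pos h]
  · rw [if_neg (by rw [h]; exact lt_irrefl _), if_pos (by rw [h]; nlinarith), h]
    simp

theorem src_mid (α w : ℝ) (h0 : 0 < α) (h : (1 - α) * Real.pi ≤ |w|)
    (h2 : |w| ≤ (1 + α) * Real.pi) :
    sqrtRaisedCosine α w =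
      (1 / Real.sqrt (2 * Real.pi)) * Real.cos ((|w| - (1 - α) * Real.pi) / (4 * α)) := by
  unfold sqrtRaisedCosine
  rw [if_neg (not_lt.mpr h)]
  rcases h2.lt_or_eq with h2 | h2
  · rw [if_pos h2]
  · rw [if_neg (by rw [h2]; exact lt_irrefl _), h2]
    have : ((1 + α) * Real.pi - (1 - α) * Real.pi) / (4 * α) = Real.pi / 2 := by
      field_simp
      ring
    rw [this, Real.cos_pi_div_two, mul_zero]

theorem src_high (α w : ℝ) (h0 : 0 < α) (h : (1 + α) * Real.pi ≤ |w|) :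
    sqrtRaisedCosine α w = 0 := by
  have hp := Real.pi_pos
  unfold sqrtRaisedCosine
  rw [if_neg (not_lt.mpr (by nlinarith)), if_neg (not_lt.mpr h)]

theorem src_two (α u : ℝ) (h0 : 0 < α) (hu : 0 ≤ u) (hu2 : u < 2 * Real.pi) :
    sqrtRaisedCosine α u ^ 2 + sqrtRaisedCosine α (u - 2 * Real.pi) ^ 2 = 1 / (2 * Real.pi) := by
  have hp := Real.pi_pos
  have e1 : |u| = u := abs_of_nonneg hu
  have e2 : |u - 2 * Real.pi| = 2 * Real.pi - u := by
    rw [abs_of_neg (by linarith)]; ring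
  have hs : (1 / Real.sqrt (2 * Real.pi)) ^ 2 = 1 / (2 * Real.pi) := by
    rw [div_pow, Real.sq_sqrt (by positivity), one_pow]
  rcases le_total u ((1 - α) * Real.pi) with h | h
  · rw [src_low α u h0 (by rw [e1]; exact h), src_high α _ h0 (by rw [e2]; linarith), hs]
    ring
  rcases le_total u ((1 + α) * Real.pi) with h' | h'
  · rw [src_mid α u h0 (by rw [e1]; exact h) (by rw [e1]; exact h'),
      src_mid α _ h0 (by rw [e2]; linarith) (by rw [e2]; linarith), e1, e2]
    have : (2 * Real.pi - u - (1 - α) * Real.pi) / (4 * α)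
        = Real.pi / 2 - (u - (1 - α) * Real.pi) / (4 * α) := by
      field_simp
      ring
    rw [this, Real.cos_pi_div_two_sub, mul_pow, mul_pow, hs, ← mul_add, Real.cos_sq_add_sin_sq,
      mul_one]
  · rw [src_high α u h0 (by rw [e1]; exact h'), src_low α _ h0 (by rw [e2]; linarith), hs]
    ring

/-- For every roll-off parameter `α ∈ (0,1)` and every `w ∈ ℝ`, the square-root raised cosine
spectrum satisfies Meyer's central condition for an orthogonal MRA:
`∑_{n ∈ ℤ} Φ_α(w + 2πn)² = 1/(2π)`. -/
theorem sqrtRaisedCosine_meyer_condition (α : ℝ) (hα : α ∈ Set.Ioo (0 : ℝ) 1) (w : ℝ) :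
    ∑' n : ℤ, (sqrtRaisedCosine α (w + 2 * Real.pi * n)) ^ 2 = 1 / (2 * Real.pi) := by
  obtain ⟨h0, h1⟩ := hα
  have hp := Real.pi_pos
  obtain ⟨k, ⟨hk, hk2⟩, -⟩ := existsUnique_add_zsmul_mem_Ico Real.two_pi_pos w 0
  set u := w + k • (2 * Real.pi) with hu
  rw [zero_add] at hk2
  rw [← (Equiv.addRight k).tsum_eq]
  have hterm : ∀ n : ℤ, w + 2 * Real.pi * ((Equiv.addRight k n : ℤ) : ℝ)
      = u + 2 * Real.pi * n := by
    intro n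
    rw [hu, Equiv.coe_addRight, zsmul_eq_mul]
    push_cast
    ring
  simp only [hterm]
  rw [tsum_eq_sum (s := {0, -1})]
  · rw [Finset.sum_pair (by norm_num), ← src_two α u h0 hk hk2]
    push_cast
    congr 3 <;> ring_nf
  · intro n hn
    simp only [Finset.mem_insert, Finset.mem_singleton, not_or] at hn
    have : 1 ≤ n ∨ n ≤ -2 := by omega
    rw [src_high α _ h0, zero_pow two_ne_zero]
    rcases this with h | h
    · have h' : (1 : ℝ) ≤ n := by exact_mod_cast h
      exact le_trans (by nlinarith) (le_abs_self _)
    · have h' : (n : ℝ) ≤ -2 := by exact_mod_cast h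
      exact le_trans (by nlinarith) (neg_le_abs _)
end

section
/- For every w ∈ ℝ with w ≠ π and w ≠ 2π, the shaping pulse of the de Oliveira wavelet converges pointwise to the shaping pulse of the complex Shannon wavelet as the roll-off parameter tends to zero: lim_{α → 0⁺} S_α(w) = 1/√(2π) if π < w < 2π, and lim_{α → 0⁺} S_α(w) = 0 otherwise. -/
/-- The shaping pulse `S_α` of the de Oliveira wavelet, for roll-off parameter `α`. -/
noncomputable def deOliveiraShape (α w : ℝ) : ℝ :=
  if w < (1 - α) * Real.pi then 0
  else if w < (1 + α) * Real.pi then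
    (1 / Real.sqrt (2 * Real.pi)) * Real.cos ((w - (1 + α) * Real.pi) / (4 * α))
  else if w < 2 * Real.pi * (1 - α) then 1 / Real.sqrt (2 * Real.pi)
  else if w < 2 * Real.pi * (1 + α) then
    (1 / Real.sqrt (2 * Real.pi)) * Real.cos ((w - 2 * Real.pi * (1 - α)) / (8 * α))
  else 0

/-- For every `w ∈ ℝ` with `w ≠ π` and `w ≠ 2π`, the shaping pulse of the de Oliveira wavelet
converges pointwise, as the roll-off `α → 0⁺`, to the shaping pulse of the complex Shannon
wavelet: the limit is `1/√(2π)` if `π < w < 2π` and `0` otherwise. -/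
theorem deOliveiraShape_tendsto_shannon (w : ℝ) (h₁ : w ≠ Real.pi) (h₂ : w ≠ 2 * Real.pi) :
    Filter.Tendsto (fun α : ℝ => deOliveiraShape α w) (nhdsWithin 0 (Set.Ioi 0))
      (nhds (if Real.pi < w ∧ w < 2 * Real.pi then 1 / Real.sqrt (2 * Real.pi) else 0)) := by
  have hpi := Real.pi_pos
  have key : ∀ c : ℝ, 0 < c →
      ∀ᶠ α in nhdsWithin (0 : ℝ) (Set.Ioi 0), 2 * Real.pi * α < c := by
    intro c hc
    have ht : Filter.Tendsto (fun α : ℝ => 2 * Real.pi * α) (nhdsWithin 0 (Set.Ioi 0))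
        (nhds (2 * Real.pi * 0)) :=
      ((continuous_const.mul continuous_id).tendsto 0).mono_left nhdsWithin_le_nhds
    rw [mul_zero] at ht
    exact ht.eventually (gt_mem_nhds hc)
  apply tendsto_const_nhds.congr'
  filter_upwards [key _ (abs_pos.mpr (sub_ne_zero.mpr h₁)),
    key _ (abs_pos.mpr (sub_ne_zero.mpr h₂)), key _ hpi, self_mem_nhdsWithin] with α a1 a2 a3 a4
  have a5 : 0 < Real.pi * α := mul_pos hpi a4
  unfold deOliveiraShape
  rcases lt_or_gt_of_ne h₁ with h | h
  · rw [abs_of_neg (by linarith)] at a1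
    rw [if_neg (by rintro ⟨h, _⟩; linarith), if_pos (by linarith)]
  · rw [abs_of_pos (by linarith)] at a1
    have b1 : ¬ w < (1 - α) * Real.pi := by linarith
    have b2 : ¬ w < (1 + α) * Real.pi := by linarith
    rw [if_neg b1, if_neg b2]
    rcases lt_or_gt_of_ne h₂ with h' | h'
    · rw [abs_of_neg (by linarith)] at a2
      rw [if_pos ⟨h, h'⟩, if_pos (by linarith)]
    · rw [abs_of_pos (by linarith)] at a2
      rw [if_neg (by rintro ⟨_, h⟩; linarith), if_neg (by linarith), if_neg (by linarith)]
end

section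
/- For every roll-off parameter α ∈ (0,1) and every t ∈ ℝ with (4αt)² ≠ 1, the de Oliveira scaling function, defined as the inverse Fourier transform φ_α(t) := (1/(2π))·∫_{ℝ} Φ_α(w)·e^{iwt} dw, is given in closed form by φ_α(t) = (1/√(2π))·(1−α)·Sinc((1−α)t) + (1/√(2π))·(4α/π)·(1/(1 − (4αt)²))·( cos(π(1+α)t) + 4αt·sin(π(1−α)t) ). -/
open MeasureTheory in
lemma src_integrable (α : ℝ) (hα : α ∈ Set.Ioo (0 : ℝ) 1) (g : ℝ → ℂ) (hg : Measurable g)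
    (hb : ∀ w, ‖g w‖ ≤ 1) :
    Integrable (fun w : ℝ => ((sqrtRaisedCosine α w : ℝ) : ℂ) * g w) := by
  have hm : Measurable (fun w : ℝ => sqrtRaisedCosine α w) := by
    unfold sqrtRaisedCosine
    refine Measurable.ite (measurableSet_lt (by fun_prop) (by fun_prop)) (by fun_prop) ?_
    exact Measurable.ite (measurableSet_lt (by fun_prop) (by fun_prop)) (by fun_prop) (by fun_prop)
  have hbd : ∀ w, |sqrtRaisedCosine α w| ≤ 1 / Real.sqrt (2 * Real.pi) := by
    intro w
    have h0 : 0 ≤ 1 / Real.sqrt (2 * Real.pi) := by positivity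
    unfold sqrtRaisedCosine
    split_ifs
    · rw [abs_of_nonneg h0]
    · rw [abs_mul, abs_of_nonneg h0]
      exact mul_le_of_le_one_right h0 (Real.abs_cos_le_one _)
    · simp
  have hs : Function.support (fun w : ℝ => ((sqrtRaisedCosine α w : ℝ) : ℂ) * g w)
      ⊆ Set.Icc (-((1 + α) * Real.pi)) ((1 + α) * Real.pi) := by
    intro w hw
    by_contra hn
    apply hw
    have h1 : (1 + α) * Real.pi < |w| := by
      by_contra h
      exact hn (abs_le.mp (not_lt.mp h))
    have h2 : ¬ |w| < (1 - α) * Real.pi := by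
      have := mul_pos hα.1 Real.pi_pos
      nlinarith
    simp [sqrtRaisedCosine, h2, not_lt.mpr h1.le]
  rw [← integrableOn_iff_integrable_of_support_subset hs]
  refine Measure.integrableOn_of_bounded (M := 1 / Real.sqrt (2 * Real.pi)) (by simp) ?_ ?_
  · exact ((Complex.measurable_ofReal.comp hm).mul hg).aestronglyMeasurable
  · refine Filter.Eventually.of_forall fun w => ?_
    rw [norm_mul, Complex.norm_real, Real.norm_eq_abs]
    exact (mul_le_of_le_one_right (abs_nonneg _) (hb w)).trans (hbd w)

open MeasureTheory in
lemma src_even (α : ℝ) (hα : α ∈ Set.Ioo (0 : ℝ) 1) (t : ℝ) :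
    ∫ w : ℝ, ((sqrtRaisedCosine α w : ℝ) : ℂ) * Complex.exp (Complex.I * w * t)
      = ((∫ w : ℝ, sqrtRaisedCosine α w * Real.cos (w * t) : ℝ) : ℂ) := by
  have hc := src_integrable α hα (fun w => ((Real.cos (w * t) : ℝ) : ℂ)) (by fun_prop)
    (fun w => by rw [Complex.norm_real]; exact Real.abs_cos_le_one _)
  have hs := src_integrable α hα (fun w => ((Real.sin (w * t) : ℝ) : ℂ)) (by fun_prop)
    (fun w => by rw [Complex.norm_real]; exact Real.abs_sin_le_one _)
  have h0 : ∫ w : ℝ, ((sqrtRaisedCosine α w : ℝ) : ℂ) * ((Real.sin (w * t) : ℝ) : ℂ) = 0 := by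
    have h := integral_neg_eq_self
      (fun w : ℝ => ((sqrtRaisedCosine α w : ℝ) : ℂ) * ((Real.sin (w * t) : ℝ) : ℂ)) volume
    have e : ∀ w : ℝ, ((sqrtRaisedCosine α (-w) : ℝ) : ℂ) * ((Real.sin (-w * t) : ℝ) : ℂ)
       = - (((sqrtRaisedCosine α w : ℝ) : ℂ) * ((Real.sin (w * t) : ℝ) : ℂ)) := by
      intro w
      rw [neg_mul, Real.sin_neg]
      simp [sqrtRaisedCosine]
    simp only [e] at h
    rw [integral_neg] at h
    exact self_eq_neg.mp h.symm
  have e : ∀ w : ℝ, ((sqrtRaisedCosine α w : ℝ) : ℂ) * Complex.exp (Complex.I * w * t)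
      = ((sqrtRaisedCosine α w : ℝ) : ℂ) * ((Real.cos (w * t) : ℝ) : ℂ)
        + (((sqrtRaisedCosine α w : ℝ) : ℂ) * ((Real.sin (w * t) : ℝ) : ℂ)) * Complex.I := by
    intro w
    rw [show Complex.I * w * t = ((w * t : ℝ) : ℂ) * Complex.I by push_cast; ring,
      Complex.exp_mul_I]
    push_cast
    ring
  simp only [e]
  rw [integral_add hc (hs.mul_const _), integral_mul_const, h0, zero_mul, add_zero,
    ← integral_complex_ofReal]
  simp

open MeasureTheory in
lemma src_real (α : ℝ) (hα : α ∈ Set.Ioo (0 : ℝ) 1) (t : ℝ) :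
    ∫ w : ℝ, sqrtRaisedCosine α w * Real.cos (w * t)
      = 2 * ((∫ w in (0:ℝ)..((1 - α) * Real.pi),
            1 / Real.sqrt (2 * Real.pi) * Real.cos (w * t))
        + ∫ w in ((1 - α) * Real.pi)..((1 + α) * Real.pi),
            1 / Real.sqrt (2 * Real.pi) * (Real.cos ((w - (1 - α) * Real.pi) / (4 * α))
              * Real.cos (w * t))) := by
  obtain ⟨h0, h1⟩ := hα
  have hπ := Real.pi_pos
  have ha : 0 < (1 - α) * Real.pi := mul_pos (by linarith) hπ
  have hab : (1 - α) * Real.pi < (1 + α) * Real.pi := by nlinarith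
  have hI := src_integrable α ⟨h0, h1⟩ (fun w => ((Real.cos (w * t) : ℝ) : ℂ)) (by fun_prop)
    (fun w => by rw [Complex.norm_real]; exact Real.abs_cos_le_one _)
  have hR : Integrable (fun w : ℝ => sqrtRaisedCosine α w * Real.cos (w * t)) := by
    simpa [← Complex.ofReal_mul, -Complex.ofReal_cos] using hI.re
  have e : ∀ w : ℝ, sqrtRaisedCosine α w * Real.cos (w * t)
      = (fun x => sqrtRaisedCosine α x * Real.cos (x * t)) |w| := by
    intro w
    have : Real.cos (|w| * t) = Real.cos (w * t) := by
      rcases abs_choice w with h | h <;> rw [h]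
      rw [neg_mul, Real.cos_neg]
    simp [sqrtRaisedCosine, this]
  rw [integral_congr_ae (Filter.Eventually.of_forall e),
    integral_comp_abs (f := fun x => sqrtRaisedCosine α x * Real.cos (x * t))]
  congr 1
  rw [setIntegral_eq_of_subset_of_forall_sdiff_eq_zero (s := Set.Ioc 0 ((1 + α) * Real.pi))
    measurableSet_Ioi (fun x hx => hx.1)]
  · rw [← intervalIntegral.integral_of_le (by linarith),
      ← intervalIntegral.integral_add_adjacent_intervals (b := (1 - α) * Real.pi)
        hR.intervalIntegrable hR.intervalIntegrable]
    congr 1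
    · refine intervalIntegral.integral_congr fun w hw => ?_
      rw [Set.uIcc_of_le ha.le] at hw
      have hw' : |w| = w := abs_of_nonneg hw.1
      simp only [sqrtRaisedCosine, hw']
      rcases hw.2.lt_or_eq with h | h
      · simp [h]
      · subst h
        simp [hab]
    · refine intervalIntegral.integral_congr fun w hw => ?_
      rw [Set.uIcc_of_le hab.le] at hw
      have hw' : |w| = w := abs_of_nonneg (ha.le.trans hw.1)
      simp only [sqrtRaisedCosine, hw', not_lt.mpr hw.1, if_false]
      rcases hw.2.lt_or_eq with h | h
      · simp [h, mul_assoc]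
      · subst h
        have : ((1 + α) * Real.pi - (1 - α) * Real.pi) / (4 * α) = Real.pi / 2 := by
          field_simp; ring
        simp [this]
  · intro w hw
    have hw0 : 0 < w := hw.1
    have hw1 : (1 + α) * Real.pi < w := by
      by_contra h
      exact hw.2 ⟨hw0, not_lt.mp h⟩
    simp [sqrtRaisedCosine, abs_of_pos hw0, not_lt.mpr hw1.le, not_lt.mpr (hab.trans hw1).le]

lemma src_second (α : ℝ) (hα : α ∈ Set.Ioo (0 : ℝ) 1) (t : ℝ) (ht : (4 * α * t) ^ 2 ≠ 1) :
    ∫ w in ((1 - α) * Real.pi)..((1 + α) * Real.pi),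
      (Real.cos ((w - (1 - α) * Real.pi) / (4 * α)) * Real.cos (w * t))
    = 4 * α * (1 / (1 - (4 * α * t) ^ 2)) * (Real.cos (Real.pi * (1 + α) * t)
              + 4 * α * t * Real.sin (Real.pi * (1 - α) * t)) := by
  have h0 : α ≠ 0 := hα.1.ne'
  have hd : 1 - (4 * α * t) ^ 2 ≠ 0 := fun h => ht (by linarith)
  have key : ∀ w ∈ Set.uIcc ((1 - α) * Real.pi) ((1 + α) * Real.pi), HasDerivAt
      (fun w : ℝ => 4 * α * (1 / (1 - (4 * α * t) ^ 2)) *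
        (Real.sin ((w - (1 - α) * Real.pi) / (4 * α)) * Real.cos (w * t)
          - 4 * α * t * (Real.cos ((w - (1 - α) * Real.pi) / (4 * α)) * Real.sin (w * t))))
      (Real.cos ((w - (1 - α) * Real.pi) / (4 * α)) * Real.cos (w * t)) w := by
    intro w _
    have hu : HasDerivAt (fun w : ℝ => (w - (1 - α) * Real.pi) / (4 * α)) (1 / (4 * α)) w :=
      ((hasDerivAt_id w).sub_const _).div_const _
    have hv : HasDerivAt (fun w : ℝ => w * t) t w := by
      simpa using (hasDerivAt_id w).mul_const t
    refine HasDerivAt.congr_deriv (((hu.sin.mul hv.cos).sub ((hu.cos.mul hv.sin).const_mul (4 * α * t))).const_mul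
      (4 * α * (1 / (1 - (4 * α * t) ^ 2)))) ?_
    generalize Real.cos ((w - (1 - α) * Real.pi) / (4 * α)) = A
    generalize Real.sin ((w - (1 - α) * Real.pi) / (4 * α)) = B
    generalize Real.cos (w * t) = C
    generalize Real.sin (w * t) = D
    have h4 : 4 * α * (1 / (4 * α)) = 1 := by field_simp
    have hE : 1 / (1 - (4 * α * t) ^ 2) * (1 - (4 * α * t) ^ 2) = 1 := one_div_mul_cancel hd
    generalize 1 / (1 - (4 * α * t) ^ 2) = E at *
    generalize 1 / (4 * α) = k at *
    linear_combination A * C * hE + (E * A * C + E * 4 * α * t * B * D) * h4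
  rw [intervalIntegral.integral_eq_sub_of_hasDerivAt key
    (Continuous.intervalIntegrable (by fun_prop) _ _)]
  have e1 : ((1 + α) * Real.pi - (1 - α) * Real.pi) / (4 * α) = Real.pi / 2 := by
    field_simp; ring
  rw [e1, sub_self, zero_div, Real.sin_zero, Real.cos_zero, Real.sin_pi_div_two,
    Real.cos_pi_div_two, mul_comm Real.pi (1 + α), mul_comm Real.pi (1 - α)]
  ring

lemma src_first (α : ℝ) (hα : α ∈ Set.Ioo (0 : ℝ) 1) (t : ℝ) :
    ∫ w in (0:ℝ)..((1 - α) * Real.pi), Real.cos (w * t)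
    = Real.pi * ((1 - α) * Sinc ((1 - α) * t)) := by
  have h1 : 1 - α ≠ 0 := by have := hα.2; linarith
  by_cases h : t = 0
  · subst h
    simp [Sinc]
    ring
  · rw [intervalIntegral.integral_comp_mul_right (fun x => Real.cos x) h, integral_cos]
    have hπ := Real.pi_ne_zero
    simp only [Sinc, mul_eq_zero, h1, h, or_self, if_false, zero_mul, Real.sin_zero, sub_zero,
      smul_eq_mul]
    rw [show (1 - α) * Real.pi * t = Real.pi * ((1 - α) * t) by ring]
    field_simp

/-- For every roll-off parameter `α ∈ (0,1)` and every `t ∈ ℝ` with `(4αt)² ≠ 1`, the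
de Oliveira scaling function `φ_α(t) = (1/(2π))·∫_{ℝ} Φ_α(w)·e^{iwt} dw` is given in closed form
by `φ_α(t) = (1/√(2π))·(1−α)·Sinc((1−α)t)
  + (1/√(2π))·(4α/π)·(1/(1 − (4αt)²))·( cos(π(1+α)t) + 4αt·sin(π(1−α)t) )`. -/
theorem deOliveira_scaling_closed_form (α : ℝ) (hα : α ∈ Set.Ioo (0 : ℝ) 1) (t : ℝ)
    (ht : (4 * α * t) ^ 2 ≠ 1) :
    (1 / (2 * (Real.pi : ℂ))) *
        ∫ w : ℝ, ((sqrtRaisedCosine α w : ℝ) : ℂ) * Complex.exp (Complex.I * w * t)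
      = (((1 / Real.sqrt (2 * Real.pi)) * (1 - α) * Sinc ((1 - α) * t)
          + (1 / Real.sqrt (2 * Real.pi)) * (4 * α / Real.pi) * (1 / (1 - (4 * α * t) ^ 2))
            * (Real.cos (Real.pi * (1 + α) * t)
              + 4 * α * t * Real.sin (Real.pi * (1 - α) * t)) : ℝ) : ℂ) := by
  rw [src_even α hα t, src_real α hα t, intervalIntegral.integral_const_mul,
    intervalIntegral.integral_const_mul, src_second α hα t ht, src_first α hα t]
  rw [show (1 / (2 * (Real.pi : ℂ))) = ((1 / (2 * Real.pi) : ℝ) : ℂ) by push_cast; rfl,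
    ← Complex.ofReal_mul]
  congr 1
  have hπ := Real.pi_ne_zero
  have hd : 1 - (4 * α * t) ^ 2 ≠ 0 := fun h => ht (by linarith)
  generalize 1 / (1 - (4 * α * t) ^ 2) = E
  generalize 1 / Real.sqrt (2 * Real.pi) = F
  field_simp
end

section
/- (Two-scale relation) For every roll-off parameter α with 0 < α ≤ 1/3 and every w ∈ ℝ, the square-root raised cosine spectrum satisfies the refinement identity Φ_α(w) = √(2π)·Φ_α(w)·Φ_α(w/2); that is, with low-pass filter H(w) := 2√π · Φ_α(2w), one has Φ_α(w) = (1/√2)·H(w/2)·Φ_α(w/2) for all w ∈ ℝ. -/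
/-- (Two-scale relation) For every roll-off parameter `α` with `0 < α ≤ 1/3` and every `w ∈ ℝ`,
the square-root raised cosine spectrum satisfies `Φ_α(w) = √(2π)·Φ_α(w)·Φ_α(w/2)`; that is, with
low-pass filter `H(w) := 2√π · Φ_α(2w)`, one has `Φ_α(w) = (1/√2)·H(w/2)·Φ_α(w/2)`. -/
theorem sqrtRaisedCosine_two_scale (α : ℝ) (hα : α ∈ Set.Ioc (0 : ℝ) (1 / 3)) (w : ℝ) :
    sqrtRaisedCosine α w
        = Real.sqrt (2 * Real.pi) * sqrtRaisedCosine α w * sqrtRaisedCosine α (w / 2)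
      ∧ sqrtRaisedCosine α w
        = (1 / Real.sqrt 2) * ((fun v : ℝ => 2 * Real.sqrt Real.pi * sqrtRaisedCosine α (2 * v))
            (w / 2)) * sqrtRaisedCosine α (w / 2) := by
  obtain ⟨h0, h1⟩ := hα
  have hpi := Real.pi_pos
  have hs : Real.sqrt (2 * Real.pi) ≠ 0 := (Real.sqrt_pos.mpr (by positivity)).ne'
  have key : sqrtRaisedCosine α w
      = Real.sqrt (2 * Real.pi) * sqrtRaisedCosine α w * sqrtRaisedCosine α (w / 2) := by
    by_cases h : |w| < (1 + α) * Real.pi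
    · have h2 : |w / 2| < (1 - α) * Real.pi := by
        rw [abs_div, abs_two]
        nlinarith
      have h3 : sqrtRaisedCosine α (w / 2) = 1 / Real.sqrt (2 * Real.pi) := by
        unfold sqrtRaisedCosine
        rw [if_pos h2]
      rw [h3]
      field_simp
    · have h2 : ¬ |w| < (1 - α) * Real.pi := by
        intro h3
        apply h
        nlinarith
      have h3 : sqrtRaisedCosine α w = 0 := by
        unfold sqrtRaisedCosine
        rw [if_neg h2, if_neg h]
      rw [h3]
      ring
  refine ⟨key, ?_⟩
  have e : 2 * (w / 2) = w := by ring
  have hc : 1 / Real.sqrt 2 * (2 * Real.sqrt Real.pi) = Real.sqrt (2 * Real.pi) := by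
    rw [Real.sqrt_mul (by norm_num)]
    have h2 : Real.sqrt 2 ≠ 0 := by positivity
    have h4 : Real.sqrt 2 * Real.sqrt 2 = 2 := Real.mul_self_sqrt (by norm_num)
    rw [one_div, inv_mul_eq_iff_eq_mul₀ h2, ← mul_assoc, h4]
  beta_reduce
  rw [e, ← mul_assoc (1 / Real.sqrt 2), hc]
  exact key
end

section
/- For every roll-off parameter α ∈ (0, 1/3) and every w ∈ ℝ, the product √(2π)·Φ_α(w − 2π)·Φ_α(w/2) equals the shaping pulse S_α(w) of the de Oliveira wavelet. -/
/-- For every roll-off parameter `α ∈ (0, 1/3)` and every `w ∈ ℝ`, the product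
`√(2π)·Φ_α(w − 2π)·Φ_α(w/2)` equals the shaping pulse `S_α(w)` of the de Oliveira wavelet. -/
theorem deOliveiraShape_eq_product (α : ℝ) (hα : α ∈ Set.Ioo (0 : ℝ) (1 / 3)) (w : ℝ) :
    Real.sqrt (2 * Real.pi) * sqrtRaisedCosine α (w - 2 * Real.pi) * sqrtRaisedCosine α (w / 2)
      = deOliveiraShape α w := by
  obtain ⟨h0, h1⟩ := hα
  have hpi := Real.pi_pos
  have hp : 0 < α * Real.pi := mul_pos h0 hpi
  have hp3 : 3 * (α * Real.pi) < Real.pi := by nlinarith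
  have hs : Real.sqrt (2 * Real.pi) ≠ 0 := (Real.sqrt_pos.2 (by linarith)).ne'
  unfold sqrtRaisedCosine deOliveiraShape
  by_cases c1 : w < (1 - α) * Real.pi
  · have e : |w - 2 * Real.pi| = 2 * Real.pi - w := by
      rw [abs_of_nonpos (by linarith)]; ring
    rw [e, if_pos c1, if_neg (by linarith), if_neg (by linarith)]
    ring
  rw [if_neg c1]
  have c1' := not_lt.1 c1
  have e2 : |w / 2| = w / 2 := abs_of_nonneg (by linarith)
  rw [e2]
  by_cases c2 : w < (1 + α) * Real.pi
  · have e : |w - 2 * Real.pi| = 2 * Real.pi - w := by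
      rw [abs_of_nonpos (by linarith)]; ring
    rw [e, if_pos c2, if_neg (by linarith), if_pos (by linarith : w / 2 < (1 - α) * Real.pi)]
    have ec : Real.cos ((2 * Real.pi - w - (1 - α) * Real.pi) / (4 * α))
        = Real.cos ((w - (1 + α) * Real.pi) / (4 * α)) := by
      rw [← Real.cos_neg]; congr 1; ring
    rw [ec]
    split_ifs with c3
    · field_simp
    · have hw : w = (1 - α) * Real.pi := by linarith
      have : (w - (1 + α) * Real.pi) / (4 * α) = -(Real.pi / 2) := by
        rw [hw]; field_simp; ring
      rw [this, Real.cos_neg, Real.cos_pi_div_two]; ring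
  rw [if_neg c2]
  have c2' := not_lt.1 c2
  by_cases c4 : w < 2 * Real.pi * (1 + α)
  swap
  · rw [if_neg (by linarith : ¬ w / 2 < (1 - α) * Real.pi),
      if_neg (by linarith : ¬ w / 2 < (1 + α) * Real.pi),
      if_neg (by linarith : ¬ w < 2 * Real.pi * (1 - α)), if_neg c4]
    ring
  have key : (if |w - 2 * Real.pi| < (1 - α) * Real.pi then 1 / Real.sqrt (2 * Real.pi)
      else if |w - 2 * Real.pi| < (1 + α) * Real.pi then
      (1 / Real.sqrt (2 * Real.pi)) *
        Real.cos ((|w - 2 * Real.pi| - (1 - α) * Real.pi) / (4 * α))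
      else 0) = 1 / Real.sqrt (2 * Real.pi) := by
    have hle : |w - 2 * Real.pi| ≤ (1 - α) * Real.pi :=
      abs_le.2 ⟨by linarith, by linarith⟩
    rcases hle.lt_or_eq with h | h
    · rw [if_pos h]
    · rw [h, if_neg (lt_irrefl _), if_pos (by linarith)]
      simp
  rw [key, mul_one_div_cancel hs, one_mul, if_pos c4]
  by_cases c3 : w < 2 * Real.pi * (1 - α)
  · rw [if_pos c3, if_pos (by linarith)]
  · rw [if_neg c3, if_neg (by linarith), if_pos (by linarith)]
    congr 2
    field_simp
    ring
end

section
/- For every roll-off parameter α ∈ (0, 1/3) and every t ∈ ℝ with (4αt)² ≠ 1 and (8αt)² ≠ 1, the real part of the inverse Fourier transform s_α(t) := (1/(2π))·∫_{ℝ} S_α(w)·e^{iwt} dw of the de Oliveira shaping pulse satisfies √(2π)·Re(s_α(t)) = (1/2)·( 2(1−α)·Sinc(2(1−α)t) − (1+α)·Sinc((1+α)t) ) + (2α/π)·( cos(π(1−α)t) − 4αt·sin(π(1+α)t) )/(1 − (4αt)²) + (4α/π)·( cos(2π(1+α)t) + 8αt·sin(2π(1−α)t) )/(1 − (8αt)²).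 -/
open MeasureTheory in
lemma aux_piece (a b : ℝ) (hab : a ≤ b) (g : ℝ → ℝ) (hg : Continuous g) (t : ℝ) :
    Integrable ((Set.Ico a b).indicator
      (fun w : ℝ => ((g w : ℝ) : ℂ) * Complex.exp (Complex.I * w * t))) ∧
    (∫ w : ℝ, (Set.Ico a b).indicator
      (fun w : ℝ => ((g w : ℝ) : ℂ) * Complex.exp (Complex.I * w * t)) w).re
      = ∫ w in a..b, g w * Real.cos (w * t) := by
  have hc : Continuous (fun w : ℝ => ((g w : ℝ) : ℂ) * Complex.exp (Complex.I * w * t)) := by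
    fun_prop
  constructor
  · rw [integrable_indicator_iff measurableSet_Ico]
    exact (hc.integrableOn_Icc (a := a) (b := b)).mono_set Set.Ico_subset_Icc_self
  · rw [integral_indicator measurableSet_Ico, integral_Ico_eq_integral_Ioc,
      ← intervalIntegral.integral_of_le hab]
    have := Complex.reCLM.intervalIntegral_comp_comm (hc.intervalIntegrable (μ := volume) a b)
    simp only [Complex.reCLM_apply] at this
    rw [← this]
    congr 1
    funext w
    rw [Complex.re_ofReal_mul]
    have : Complex.I * w * t = ((w * t : ℝ) : ℂ) * Complex.I := by push_cast; ring
    rw [this, Complex.exp_ofReal_mul_I_re]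

lemma aux_cos_cos (a b c k t : ℝ) (h : k ^ 2 - t ^ 2 ≠ 0) :
    ∫ w in a..b, Real.cos (k * (w - c)) * Real.cos (w * t)
      = (k * Real.sin (k * (b - c)) * Real.cos (b * t)
          - t * Real.cos (k * (b - c)) * Real.sin (b * t)) / (k ^ 2 - t ^ 2)
        - (k * Real.sin (k * (a - c)) * Real.cos (a * t)
          - t * Real.cos (k * (a - c)) * Real.sin (a * t)) / (k ^ 2 - t ^ 2) := by
  refine intervalIntegral.integral_eq_sub_of_hasDerivAt
    (f := fun w => (k * Real.sin (k * (w - c)) * Real.cos (w * t)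
          - t * Real.cos (k * (w - c)) * Real.sin (w * t)) / (k ^ 2 - t ^ 2)) ?_
    (Continuous.intervalIntegrable (by fun_prop) _ _)
  intro w _
  have h1 : HasDerivAt (fun w => k * (w - c)) k w := by
    simpa using ((hasDerivAt_id w).sub_const c).const_mul k
  have h2 : HasDerivAt (fun w => w * t) t w := by
    simpa using (hasDerivAt_id w).mul_const t
  have := ((((h1.sin.const_mul k).mul h2.cos).sub
    ((h1.cos.const_mul t).mul h2.sin)).div_const (k ^ 2 - t ^ 2))
  refine this.congr_deriv ?_
  field_simp
  ring

lemma aux_cos (a b t : ℝ) :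
    ∫ w in a..b, Real.cos (w * t)
      = Real.pi * (b / Real.pi * Sinc (b / Real.pi * t) - a / Real.pi * Sinc (a / Real.pi * t)) := by
  have hpi := Real.pi_ne_zero
  by_cases ht : t = 0
  · subst ht
    simp [Sinc]
    field_simp
  · have key : ∀ x : ℝ, x / Real.pi * Sinc (x / Real.pi * t) = Real.sin (x * t) / (Real.pi * t) := by
      intro x
      by_cases hx : x = 0
      · simp [hx]
      · have : x / Real.pi * t ≠ 0 := by positivity
        rw [Sinc, if_neg this]
        have e : Real.pi * (x / Real.pi * t) = x * t := by field_simp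
        rw [e]
        field_simp
    rw [key, key, intervalIntegral.integral_comp_mul_right _ ht, integral_cos]
    simp only [smul_eq_mul]
    field_simp

lemma aux_shape (α : ℝ) (h0 : 0 < α) (h1 : α < 1 / 3) (w : ℝ) (E : ℂ) :
    ((deOliveiraShape α w : ℝ) : ℂ) * E =
      (Set.Ico ((1 - α) * Real.pi) ((1 + α) * Real.pi)).indicator (fun w : ℝ =>
        (((1 / Real.sqrt (2 * Real.pi)) * Real.cos (1 / (4 * α) * (w - (1 + α) * Real.pi)) : ℝ) : ℂ)
          * E) w
      + (Set.Ico ((1 + α) * Real.pi) (2 * Real.pi * (1 - α))).indicator (fun w : ℝ =>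
        ((1 / Real.sqrt (2 * Real.pi) : ℝ) : ℂ) * E) w
      + (Set.Ico (2 * Real.pi * (1 - α)) (2 * Real.pi * (1 + α))).indicator (fun w : ℝ =>
        (((1 / Real.sqrt (2 * Real.pi)) * Real.cos (1 / (8 * α) * (w - 2 * Real.pi * (1 - α))) : ℝ) : ℂ)
          * E) w := by
  have hp := Real.pi_pos
  have e1 : (1 - α) * Real.pi < (1 + α) * Real.pi := by nlinarith
  have e2 : (1 + α) * Real.pi < 2 * Real.pi * (1 - α) := by nlinarith
  have e3 : 2 * Real.pi * (1 - α) < 2 * Real.pi * (1 + α) := by nlinarith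
  have c1 : (w - (1 + α) * Real.pi) / (4 * α) = 1 / (4 * α) * (w - (1 + α) * Real.pi) := by ring
  have c2 : (w - 2 * Real.pi * (1 - α)) / (8 * α) = 1 / (8 * α) * (w - 2 * Real.pi * (1 - α)) := by
    ring
  simp only [deOliveiraShape, Set.indicator_apply, Set.mem_Ico, c1, c2]
  generalize (1 - α) * Real.pi = A at *
  generalize (1 + α) * Real.pi = B at *
  generalize 2 * Real.pi * (1 - α) = C at *
  generalize 2 * Real.pi * (1 + α) = D at *
  clear c1 c2
  rcases lt_or_ge w A with hA | hA
  · simp [hA, not_le.2 hA, not_le.2 (hA.trans e1), not_le.2 (hA.trans (e1.trans e2))]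
  rcases lt_or_ge w B with hB | hB
  · simp [hA, hB, not_lt.2 hA, not_le.2 hB, not_le.2 (hB.trans e2)]
  rcases lt_or_ge w C with hC | hC
  · simp [hA, hB, hC, not_lt.2 hA, not_lt.2 hB, not_le.2 hC]
  rcases lt_or_ge w D with hD | hD
  · simp [hA, hB, hC, hD, not_lt.2 hA, not_lt.2 hB, not_lt.2 hC]
  · simp [not_lt.2 hA, not_lt.2 hB, not_lt.2 hC, not_lt.2 hD]

/-- For every roll-off parameter `α ∈ (0, 1/3)` and every `t ∈ ℝ` with `(4αt)² ≠ 1` and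
`(8αt)² ≠ 1`, the real part of the inverse Fourier transform
`s_α(t) = (1/(2π))·∫_{ℝ} S_α(w)·e^{iwt} dw` of the de Oliveira shaping pulse satisfies
`√(2π)·Re(s_α(t)) = (1/2)·( 2(1−α)·Sinc(2(1−α)t) − (1+α)·Sinc((1+α)t) )
  + (2α/π)·( cos(π(1−α)t) − 4αt·sin(π(1+α)t) )/(1 − (4αt)²)
  + (4α/π)·( cos(2π(1+α)t) + 8αt·sin(2π(1−α)t) )/(1 − (8αt)²)`. -/
theorem deOliveira_wavelet_re (α : ℝ) (hα : α ∈ Set.Ioo (0 : ℝ) (1 / 3)) (t : ℝ)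
    (h₁ : (4 * α * t) ^ 2 ≠ 1) (h₂ : (8 * α * t) ^ 2 ≠ 1) :
    Real.sqrt (2 * Real.pi) *
        ((1 / (2 * (Real.pi : ℂ))) *
          ∫ w : ℝ, ((deOliveiraShape α w : ℝ) : ℂ) * Complex.exp (Complex.I * w * t)).re
      = (1 / 2) * (2 * (1 - α) * Sinc (2 * (1 - α) * t) - (1 + α) * Sinc ((1 + α) * t))
        + (2 * α / Real.pi)
          * (Real.cos (Real.pi * (1 - α) * t) - 4 * α * t * Real.sin (Real.pi * (1 + α) * t))
          / (1 - (4 * α * t) ^ 2)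
        + (4 * α / Real.pi)
          * (Real.cos (2 * Real.pi * (1 + α) * t)
              + 8 * α * t * Real.sin (2 * Real.pi * (1 - α) * t))
          / (1 - (8 * α * t) ^ 2) := by
  obtain ⟨h0, h3⟩ := hα
  have hp := Real.pi_pos
  have e1 : (1 - α) * Real.pi ≤ (1 + α) * Real.pi := by nlinarith
  have e2 : (1 + α) * Real.pi ≤ 2 * Real.pi * (1 - α) := by nlinarith
  have e3 : 2 * Real.pi * (1 - α) ≤ 2 * Real.pi * (1 + α) := by nlinarith
  obtain ⟨i1, r1⟩ := aux_piece _ _ e1 (fun w => (1 / Real.sqrt (2 * Real.pi)) *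
    Real.cos (1 / (4 * α) * (w - (1 + α) * Real.pi))) (by fun_prop) t
  obtain ⟨i2, r2⟩ := aux_piece _ _ e2 (fun w => (1 / Real.sqrt (2 * Real.pi))) (by fun_prop) t
  obtain ⟨i3, r3⟩ := aux_piece _ _ e3 (fun w => (1 / Real.sqrt (2 * Real.pi)) *
    Real.cos (1 / (8 * α) * (w - 2 * Real.pi * (1 - α)))) (by fun_prop) t
  have hI := (MeasureTheory.integral_add (i1.add i2) i3)
  have hI' := (MeasureTheory.integral_add i1 i2)
  have hint := Eq.trans
    (a := ∫ w : ℝ, ((deOliveiraShape α w : ℝ) : ℂ) * Complex.exp (Complex.I * w * t)) (by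
      congr 1
      funext w
      rw [aux_shape α h0 h3 w]
      simp only [Pi.add_apply, Set.indicator_apply]) hI
  simp only [Pi.add_apply] at hint
  rw [hI'] at hint
  rw [hint]
  have hs : (1 / (2 * (Real.pi : ℂ))) = ((1 / (2 * Real.pi) : ℝ) : ℂ) := by push_cast; rfl
  rw [hs, Complex.re_ofReal_mul, Complex.add_re, Complex.add_re, r1, r2, r3]
  have hk1 : 1 - (4 * α * t) ^ 2 ≠ 0 := fun h => h₁ (by linarith)
  have hk2 : 1 - (8 * α * t) ^ 2 ≠ 0 := fun h => h₂ (by linarith)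
  have q1 : (1 / (4 * α)) ^ 2 - t ^ 2 = (1 - (4 * α * t) ^ 2) / (16 * α ^ 2) := by
    field_simp; ring
  have q2 : (1 / (8 * α)) ^ 2 - t ^ 2 = (1 - (8 * α * t) ^ 2) / (64 * α ^ 2) := by
    field_simp; ring
  simp only [mul_assoc (1 / Real.sqrt (2 * Real.pi)), intervalIntegral.integral_const_mul]
  rw [aux_cos_cos _ _ _ _ _ (by rw [q1]; positivity), aux_cos,
    aux_cos_cos _ _ _ _ _ (by rw [q2]; positivity), q1, q2]
  have a1 : 1 / (4 * α) * ((1 - α) * Real.pi - (1 + α) * Real.pi) = -(Real.pi / 2) := by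
    field_simp; ring
  have a2 : 1 / (8 * α) * (2 * Real.pi * (1 + α) - 2 * Real.pi * (1 - α)) = Real.pi / 2 := by
    field_simp; ring
  have a3 : 2 * Real.pi * (1 - α) / Real.pi = 2 * (1 - α) := by field_simp
  have a4 : (1 + α) * Real.pi / Real.pi = 1 + α := by field_simp
  rw [a1, a2, a3, a4]
  simp only [sub_self, mul_zero, Real.sin_zero, Real.cos_zero, Real.sin_neg, Real.cos_neg,
    Real.sin_pi_div_two, Real.cos_pi_div_two]
  rw [mul_comm (1 - α) Real.pi, mul_comm (1 + α) Real.pi]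
  have hsq : Real.sqrt (2 * Real.pi) ≠ 0 := by positivity
  generalize Real.sqrt (2 * Real.pi) = s at *
  generalize Sinc (2 * (1 - α) * t) = S1
  generalize Sinc ((1 + α) * t) = S2
  generalize Real.cos (Real.pi * (1 - α) * t) = C1
  generalize Real.sin (Real.pi * (1 + α) * t) = C2
  generalize Real.cos (2 * Real.pi * (1 + α) * t) = C3
  generalize Real.sin (2 * Real.pi * (1 - α) * t) = C4
  generalize 1 - (4 * α * t) ^ 2 = K1 at *
  generalize 1 - (8 * α * t) ^ 2 = K2 at *
  clear hint hI hI' r1 r2 r3 i1 i2 i3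
  field_simp
  ring
end

section
/- For every w ∈ ℝ with |w| ≠ π, the square-root raised cosine spectrum converges pointwise to the Shannon scaling function spectrum as the roll-off parameter tends to zero: lim_{α → 0⁺} Φ_α(w) = 1/√(2π) if |w| < π, and lim_{α → 0⁺} Φ_α(w) = 0 if |w| > π. -/
/-- For every `w ∈ ℝ` with `|w| ≠ π`, the square-root raised cosine spectrum converges pointwise
to the Shannon scaling function spectrum as the roll-off parameter tends to zero:
`lim_{α → 0⁺} Φ_α(w) = 1/√(2π)` if `|w| < π`, and `lim_{α → 0⁺} Φ_α(w) = 0` if `|w| > π`. -/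
theorem sqrtRaisedCosine_tendsto_shannon (w : ℝ) (hw : |w| ≠ Real.pi) :
    Filter.Tendsto (fun α : ℝ => sqrtRaisedCosine α w) (nhdsWithin 0 (Set.Ioi 0))
      (nhds (if |w| < Real.pi then 1 / Real.sqrt (2 * Real.pi) else 0)) := by
  apply tendsto_nhds_of_eventually_eq
  have hpi := Real.pi_pos
  have c1 : Filter.Tendsto (fun α : ℝ => (1 - α) * Real.pi) (nhdsWithin 0 (Set.Ioi 0))
      (nhds Real.pi) := by
    have h : Continuous (fun α : ℝ => (1 - α) * Real.pi) := by fun_prop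
    have := (h.tendsto 0).mono_left (nhdsWithin_le_nhds (s := Set.Ioi 0))
    simpa using this
  have c2 : Filter.Tendsto (fun α : ℝ => (1 + α) * Real.pi) (nhdsWithin 0 (Set.Ioi 0))
      (nhds Real.pi) := by
    have h : Continuous (fun α : ℝ => (1 + α) * Real.pi) := by fun_prop
    have := (h.tendsto 0).mono_left (nhdsWithin_le_nhds (s := Set.Ioi 0))
    simpa using this
  rcases lt_or_gt_of_ne hw with h | h
  · filter_upwards [c1.eventually (lt_mem_nhds h)] with α hα
    rw [sqrtRaisedCosine, if_pos hα, if_pos h]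
  · filter_upwards [c1.eventually (gt_mem_nhds h), c2.eventually (gt_mem_nhds h)] with α h1 h2
    rw [sqrtRaisedCosine, if_neg (not_lt.mpr h1.le), if_neg (not_lt.mpr h2.le),
      if_neg (not_lt.mpr (le_of_lt h))]
end
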